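/- arXiv:1608.07771 — 8 statements merged into one kernel-verified Lean document; each statement's English description precedes it below -/
import Mathlib

section
/- Let A be a unital associative algebra over ℂ and q ∈ ℂ with q ≠ 0 and q² ≠ −1. Suppose x, y, z ∈ A satisfy [y,[y,x]_q]_{q^{-1}} = 0, [y,[y,z]_q]_{q^{-1}} = 0, and [x,z] = 0. Then [[x,y]_{q^{-1}}, [y,z]_q] = 0. -/
/-- The twisted q-commutator `[u,v]_t = u*v - t*(v*u)`. -/
def qcomm {A : Type*} [Ring A] [Algebra ℂ A] (t : ℂ) (u v : A) : A :=
  u * v - t • (v * u)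

/-- Under the q-Serre relations for `y` against `x` and `z`, and `[x,z] = 0`,
the elements `[x,y]_{q⁻¹}` and `[y,z]_q` commute. -/
theorem qcomm_commute {A : Type*} [Ring A] [Algebra ℂ A]
    (q : ℂ) (hq : q ≠ 0) (hq2 : q ^ 2 ≠ -1) (x y z : A)
    (hx : qcomm q⁻¹ y (qcomm q y x) = 0)
    (hz : qcomm q⁻¹ y (qcomm q y z) = 0)
    (hxz : x * z - z * x = 0) :
    qcomm q⁻¹ x y * qcomm q y z - qcomm q y z * qcomm q⁻¹ x y = 0 := by
  have hp : q + q⁻¹ ≠ 0 := by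
    intro h
    apply hq2
    field_simp at h
    linear_combination h
  have hcomm : z * x = x * z := (sub_eq_zero.mp hxz).symm
  have hcomm' (w : A) : z * (x * w) = x * (z * w) := by
    rw [← mul_assoc, hcomm, mul_assoc]
  have hxz_right := congrArg (· * z) hx
  have hxz_left := congrArg (z * ·) hx
  have hzx_right := congrArg (· * x) hz
  have hzx_left := congrArg (x * ·) hz
  simp only [qcomm, mul_sub, sub_mul, smul_sub, mul_smul_comm, smul_mul_assoc, smul_smul,
    mul_assoc, hcomm, hcomm', mul_zero, zero_mul, inv_mul_cancel₀ hq, mul_inv_cancel₀ hq,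
    one_smul] at hxz_right hxz_left hzx_right hzx_left ⊢
  apply (smul_eq_zero_iff_right hp).mp
  linear_combination (norm := skip) q⁻¹ • (hxz_right - hzx_right) + q • (hzx_left - hxz_left)
  match_scalars <;> field_simp <;> ring
end

section
/- Let A be a unital associative algebra over ℂ and q ∈ ℂ with q ≠ 0 and q² ≠ −1. Suppose x, y, z ∈ A satisfy [y,[y,x]_q]_{q^{-1}} = 0, [y,[y,z]_q]_{q^{-1}} = 0, and [x,z] = 0. Then [y, [x, [y,z]_q]_q] = 0. -/
/-- The `q`-Serre relation in expanded form, with denominators cleared. -/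
theorem qcomm_serre_expand {A : Type*} [Ring A] [Algebra ℂ A] {q : ℂ} (hq : q ≠ 0) {x y : A}
    (h : qcomm q⁻¹ y (qcomm q y x) = 0) :
    q • (y * (y * x)) - (q ^ 2 + 1) • (y * (x * y)) + q • (x * (y * y)) = 0 := by
  have h' := congrArg (q • ·) h
  simp only [qcomm, mul_sub, sub_mul, mul_smul_comm, smul_mul_assoc, smul_sub, smul_smul,
    mul_assoc, smul_zero, mul_inv_cancel₀ hq, inv_mul_cancel₀ hq,
    one_smul] at h'
  linear_combination (norm := module) h'

/-- Under the q-Serre relations for `y` against `x` and `z`, and `[x,z] = 0`,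
one has `[y, [x,[y,z]_q]_q] = 0`. -/
theorem qcomm_second {A : Type*} [Ring A] [Algebra ℂ A]
    (q : ℂ) (hq : q ≠ 0) (hq2 : q ^ 2 ≠ -1) (x y z : A)
    (hx : qcomm q⁻¹ y (qcomm q y x) = 0)
    (hz : qcomm q⁻¹ y (qcomm q y z) = 0)
    (hxz : x * z - z * x = 0) :
    y * qcomm q x (qcomm q y z) - qcomm q x (qcomm q y z) * y = 0 := by
  have hs : q ^ 2 + 1 ≠ 0 := fun h => hq2 (eq_neg_of_add_eq_zero_left h)
  have hX := qcomm_serre_expand hq hx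
  have hZ := qcomm_serre_expand hq hz
  have hc : z * x = x * z := (sub_eq_zero.mp hxz).symm
  have hc' (w : A) : z * (x * w) = x * (z * w) := by rw [← mul_assoc, hc, mul_assoc]
  have hXz := congrArg (· * z) hX
  have hzX := congrArg (z * ·) hX
  have hZx := congrArg (· * x) hZ
  have hxZ := congrArg (x * ·) hZ
  refine (smul_eq_zero_iff_right hs).mp ?_
  simp only [qcomm, mul_sub, sub_mul, mul_add, add_mul, mul_smul_comm, smul_mul_assoc, mul_assoc,
    hc, hc', mul_zero, zero_mul] at hXz hzX hZx hxZ ⊢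
  linear_combination (norm := module) -hXz - q ^ 2 • hZx + hxZ + q ^ 2 • hzX
end

section
/- Let A be a unital associative algebra over ℂ and q ∈ ℂ with q ≠ 0. Suppose x, y, z ∈ A satisfy [y,[y,x]_q]_{q^{-1}} = 0, [y,[y,z]_q]_{q^{-1}} = 0, and [x,z] = 0. Then [[x,y]_{q^{-1}}, [y,z]_q]_{q^{-2}} = [[y,z]_q, [x,y]_{q^{-1}}]_{q^{-2}}. -/
/-- Under the q-Serre relations for `y` against `x` and `z`, and `[x,z] = 0`,
one has `[[x,y]_{q⁻¹}, [y,z]_q]_{q⁻²} = [[y,z]_q, [x,y]_{q⁻¹}]_{q⁻²}`. -/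
theorem qcomm_symm {A : Type*} [Ring A] [Algebra ℂ A]
    (q : ℂ) (hq : q ≠ 0) (x y z : A)
    (hx : qcomm q⁻¹ y (qcomm q y x) = 0)
    (hz : qcomm q⁻¹ y (qcomm q y z) = 0)
    (hxz : x * z - z * x = 0) :
    qcomm (q⁻¹ ^ 2) (qcomm q⁻¹ x y) (qcomm q y z) =
      qcomm (q⁻¹ ^ 2) (qcomm q y z) (qcomm q⁻¹ x y) := by
  have key : qcomm (q⁻¹ ^ 2) (qcomm q⁻¹ x y) (qcomm q y z) -
      qcomm (q⁻¹ ^ 2) (qcomm q y z) (qcomm q⁻¹ x y) =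
      x * qcomm q⁻¹ y (qcomm q y z)
        + (q⁻¹ ^ 2) • (qcomm q⁻¹ y (qcomm q y x) * z - qcomm q⁻¹ y (qcomm q y z) * x)
        - z * qcomm q⁻¹ y (qcomm q y x)
        + (1 + q⁻¹ ^ 2) • (y * (x * z - z * x) * y)
        - (x * z - z * x) * y * y - (q⁻¹ ^ 2) • (y * y * (x * z - z * x)) := by
    simp only [qcomm, mul_sub, sub_mul, smul_sub, mul_smul_comm, smul_mul_assoc, mul_assoc]
    match_scalars <;> field_simp <;> ring
  rw [← sub_eq_zero, key, hx, hz, hxz]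
  simp
end

section
/- Let A be a unital associative algebra over ℂ, q ∈ ℂ with q ≠ 0 and a := q + q^{-1} ≠ 0. Let f₁, f₂ ∈ A, set f_δ := f₁²f₂ − a·f₁f₂f₁ + f₂f₁², and assume f_δ·f₁ = f₁·f_δ. Let J ⊆ A be the left ideal generated by f₂ and f_δ. Then: (i) f₁f₂f₁ − a^{-1}·f₂f₁² ∈ J; (ii) f₂f₁³ − (a − a^{-1})·f₁f₂f₁² ∈ J; (iii) f₂f₁³ − (a² − 1)·f₁²f₂f₁ ∈ J. -/
/-- Relations modulo the left ideal generated by `f₂` and `f_δ`,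
where `f_δ = f₁²f₂ − a·f₁f₂f₁ + f₂f₁²` commutes with `f₁` and `a = q + q⁻¹`. -/
theorem mod_relations {A : Type*} [Ring A] [Algebra ℂ A]
    (q : ℂ) (hq : q ≠ 0) (ha : q + q⁻¹ ≠ 0) (f₁ f₂ : A)
    (fδ : A)
    (hfδ : fδ = f₁ ^ 2 * f₂ - (q + q⁻¹) • (f₁ * f₂ * f₁) + f₂ * f₁ ^ 2)
    (hcomm : fδ * f₁ = f₁ * fδ)
    (J : Submodule A A) (hJ : J = Submodule.span A ({f₂, fδ} : Set A)) :
    (f₁ * f₂ * f₁ - (q + q⁻¹)⁻¹ • (f₂ * f₁ ^ 2) ∈ J) ∧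
    (f₂ * f₁ ^ 3 - ((q + q⁻¹) - (q + q⁻¹)⁻¹) • (f₁ * f₂ * f₁ ^ 2) ∈ J) ∧
    (f₂ * f₁ ^ 3 - ((q + q⁻¹) ^ 2 - 1) • (f₁ ^ 2 * f₂ * f₁) ∈ J) := by
  set a := q + q⁻¹
  have hJ_smul (c : ℂ) {z : A} (hz : z ∈ J) : c • z ∈ J := by
    simpa [Algebra.smul_def] using J.smul_mem (algebraMap ℂ A c) hz
  have hf₂_mem : f₂ ∈ J := hJ ▸ Submodule.subset_span (by simp)
  have hfδ_mem : fδ ∈ J := hJ ▸ Submodule.subset_span (by simp)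
  have h₁ : f₁ * f₂ * f₁ - a⁻¹ • (f₂ * f₁ ^ 2) ∈ J := by
    have h := hJ_smul a⁻¹ (J.sub_mem (J.smul_mem (f₁ ^ 2) hf₂_mem) hfδ_mem)
    rw [hfδ, smul_eq_mul] at h
    convert h using 1
    match_scalars <;> field_simp
    ring
  have hf₁_h₁ : f₁ ^ 2 * f₂ * f₁ - a⁻¹ • (f₁ * f₂ * f₁ ^ 2) ∈ J := by
    simpa only [smul_eq_mul, mul_sub, mul_smul_comm, pow_two, mul_assoc] using J.smul_mem f₁ h₁
  have hexpand : f₁ * fδ = f₁ ^ 2 * f₂ * f₁ - a • (f₁ * f₂ * f₁ ^ 2) + f₂ * f₁ ^ 3 := by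
    rw [← hcomm, hfδ]
    simp only [add_mul, sub_mul, smul_mul_assoc, pow_succ, pow_zero, one_mul, mul_assoc]
  have h₂ : f₂ * f₁ ^ 3 - (a - a⁻¹) • (f₁ * f₂ * f₁ ^ 2) ∈ J := by
    have h := J.sub_mem (J.smul_mem f₁ hfδ_mem) hf₁_h₁
    rw [smul_eq_mul, hexpand] at h
    convert h using 1
    module
  refine ⟨h₁, h₂, ?_⟩
  convert J.sub_mem h₂ (hJ_smul (a ^ 2 - 1) hf₁_h₁) using 1
  match_scalars <;> field_simp
  ring
end

section
/- Let A be a unital associative algebra over ℂ and q ∈ ℂ nonzero with a := q + q^{-1} satisfying a ≠ 0 and a² ≠ 1. Let f₁, f₂, f₃ ∈ A satisfy: f₁f₃ = f₃f₁; [f₂,[f₂,f₁]_q]_{q^{-1}} = 0; [f₂,[f₂,f₃]_q]_{q^{-1}} = 0; [f₃,[f₃,f₂]_q]_{q^{-1}} = 0; and [f₁, f_δ] = 0, where f_δ := [f₁,[f₁,f₂]_q]_{q^{-1}} = f₁²f₂ − a·f₁f₂f₁ + f₂f₁². Set f_{ε₃} := [[f₁,f₂]_{q^{-1}}, f₃]_{q^{-1}}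 and let J ⊆ A be the left ideal generated by f_δ, f₂, f₃. Then f_δ·f_{ε₃} − (a(a²−1))^{-1}·(a·f₂f₃f₂ − f₃f₂²)·f₁³ ∈ J; in particular f_δ·f_{ε₃} ∈ J. -/
/-- The iterated q-commutator `[u,[u,v]_q]_{q⁻¹}` expands to the cubic q-Serre expression. -/
theorem qcomm_inv_qcomm {A : Type*} [Ring A] [Algebra ℂ A] {q : ℂ} (hq : q ≠ 0) (u v : A) :
    qcomm q⁻¹ u (qcomm q u v) =
      u * (u * v) - (q + q⁻¹) • (u * (v * u)) + v * (u * u) := by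
  simp only [qcomm, mul_sub, sub_mul, smul_sub, mul_smul_comm, smul_mul_assoc, mul_assoc,
    smul_smul, inv_mul_cancel₀ hq]
  module

/-- Operators subject to the q-Serre relations, acting on a vector killed by `F₂` and `F₃`: if the
q-Serre element `f_δ` of `F₁`, `F₂` kills `v` and `F₁ v`, then it kills `F₃ F₂ F₁ v`. -/
theorem serre_apply_eq_zero {K V : Type*} [Field K] [AddCommGroup V] [Module K V]
    {a : K} (ha : a ≠ 0) (ha2 : a ^ 2 ≠ 1) (F₁ F₂ F₃ : V →ₗ[K] V)
    (h13 : ∀ w, F₁ (F₃ w) = F₃ (F₁ w))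
    (h21 : ∀ w, F₂ (F₂ (F₁ w)) - a • F₂ (F₁ (F₂ w)) + F₁ (F₂ (F₂ w)) = 0)
    (h23 : ∀ w, F₂ (F₂ (F₃ w)) - a • F₂ (F₃ (F₂ w)) + F₃ (F₂ (F₂ w)) = 0)
    {v : V} (h2 : F₂ v = 0) (h3 : F₃ v = 0)
    (hδ : F₁ (F₁ (F₂ v)) - a • F₁ (F₂ (F₁ v)) + F₂ (F₁ (F₁ v)) = 0)
    (hδ₁ : F₁ (F₁ (F₂ (F₁ v))) - a • F₁ (F₂ (F₁ (F₁ v))) + F₂ (F₁ (F₁ (F₁ v))) = 0) :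
    F₁ (F₁ (F₂ (F₃ (F₂ (F₁ v))))) - a • F₁ (F₂ (F₁ (F₃ (F₂ (F₁ v))))) +
      F₂ (F₁ (F₁ (F₃ (F₂ (F₁ v))))) = 0 := by
  have hb : a ^ 2 - 1 ≠ 0 := sub_ne_zero.2 ha2
  have e2 : F₂ (F₁ (F₁ v)) = a • F₁ (F₂ (F₁ v)) := by
    simp only [h2, map_zero] at hδ
    linear_combination (norm := module) hδ
  have e3 : F₂ (F₁ (F₁ (F₁ v))) = (a ^ 2 - 1) • F₁ (F₁ (F₂ (F₁ v))) := by
    simp only [e2, map_smul] at hδ₁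
    linear_combination (norm := module) hδ₁
  have e22 : F₂ (F₂ (F₁ v)) = 0 := by simpa [h2] using h21 v
  have e232 : F₂ (F₃ (F₂ (F₁ v))) = 0 := by
    simpa [e22, ← h13, h3, ha] using h23 (F₁ v)
  have e3' : (a ^ 2 - 1) • F₂ (F₁ (F₁ (F₂ (F₁ v)))) = F₂ (F₂ (F₁ (F₁ (F₁ v)))) := by
    rw [e3, map_smul]
  have e22' : (a ^ 2 - 1) • F₁ (F₂ (F₂ (F₁ (F₁ v)))) = F₂ (F₂ (F₁ (F₁ (F₁ v)))) := by
    have h := h21 (F₁ (F₁ v))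
    have h' : F₂ (F₁ (F₂ (F₁ (F₁ v)))) = a • F₂ (F₁ (F₁ (F₂ (F₁ v)))) := by
      rw [e2, map_smul, map_smul]
    linear_combination (norm := module) (a ^ 2 - 1) • h + a • (a ^ 2 - 1) • h' + a ^ 2 • e3'
  have e121321 : a • a • F₁ (F₂ (F₁ (F₃ (F₂ (F₁ v))))) = F₃ (F₁ (F₂ (F₂ (F₁ (F₁ v))))) := by
    have h := congrArg F₁ (h23 (F₁ (F₁ v)))
    have h' : F₁ (F₂ (F₃ (F₂ (F₁ (F₁ v))))) = a • F₁ (F₂ (F₁ (F₃ (F₂ (F₁ v))))) := by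
      simp only [e2, map_smul, h13]
    simp only [map_add, map_sub, map_smul, ← h13, h3, map_zero] at h
    simp only [← h13] at h' ⊢
    linear_combination (norm := module) -h - a • h'
  have e211321 : a • (a ^ 2 - 1) • F₂ (F₁ (F₁ (F₃ (F₂ (F₁ v))))) =
      F₃ (F₂ (F₂ (F₁ (F₁ (F₁ v))))) := by
    have h := h23 (F₁ (F₁ (F₁ v)))
    have h' : F₂ (F₃ (F₂ (F₁ (F₁ (F₁ v))))) = (a ^ 2 - 1) • F₂ (F₁ (F₁ (F₃ (F₂ (F₁ v))))) := by
      simp only [e3, map_smul, h13]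
    simp only [← h13, h3, map_zero] at h h' ⊢
    linear_combination (norm := module) -h - a • h'
  have h := congrArg F₃ e22'
  rw [map_smul] at h
  rw [e232, map_zero, map_zero, zero_sub]
  refine (smul_eq_zero.1 ?_).resolve_left (mul_ne_zero ha hb)
  linear_combination (norm := module) e211321 - (a ^ 2 - 1) • e121321 - h

/-- The key computation of Lemma 1 (case m = 3):
`f_δ·f_{ε₃} ≡ (a(a²−1))⁻¹·(a·f₂f₃f₂ − f₃f₂²)·f₁³` modulo the left ideal
generated by `f_δ, f₂, f₃`. -/
theorem fdelta_feps3 {A : Type*} [Ring A] [Algebra ℂ A]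
    (q : ℂ) (hq : q ≠ 0) (ha : q + q⁻¹ ≠ 0) (ha2 : (q + q⁻¹) ^ 2 ≠ 1)
    (f₁ f₂ f₃ : A)
    (h13 : f₁ * f₃ = f₃ * f₁)
    (h21 : qcomm q⁻¹ f₂ (qcomm q f₂ f₁) = 0)
    (h23 : qcomm q⁻¹ f₂ (qcomm q f₂ f₃) = 0)
    (h32 : qcomm q⁻¹ f₃ (qcomm q f₃ f₂) = 0)
    (fδ : A) (hfδ : fδ = qcomm q⁻¹ f₁ (qcomm q f₁ f₂))
    (h1δ : f₁ * fδ - fδ * f₁ = 0)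
    (fε₃ : A) (hfε₃ : fε₃ = qcomm q⁻¹ (qcomm q⁻¹ f₁ f₂) f₃)
    (J : Submodule A A) (hJ : J = Submodule.span A ({fδ, f₂, f₃} : Set A)) :
    (fδ * fε₃ -
      ((q + q⁻¹) * ((q + q⁻¹) ^ 2 - 1))⁻¹ •
        (((q + q⁻¹) • (f₂ * f₃ * f₂) - f₃ * f₂ ^ 2) * f₁ ^ 3) ∈ J) ∧
    fδ * fε₃ ∈ J := by
  rw [qcomm_inv_qcomm hq] at h21 h23 hfδ
  set a := q + q⁻¹
  have hgen : ∀ x ∈ ({fδ, f₂, f₃} : Set A), ∀ y, y * x ∈ J := fun x hx y ↦ by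
    subst hJ
    exact Submodule.smul_mem _ y (Submodule.subset_span hx)
  have hδJ := hgen fδ (by simp)
  have h2J := hgen f₂ (by simp)
  have h3J := hgen f₃ (by simp)
  have key : fδ * f₃ * f₂ * f₁ ∈ J := by
    have mk_eq : ∀ x, (Submodule.Quotient.mk x : A ⧸ J) = 0 ↔ x ∈ J :=
      fun x ↦ Submodule.Quotient.mk_eq_zero J
    have h := serre_apply_eq_zero ha ha2 (Algebra.lsmul ℂ ℂ (A ⧸ J) f₁)
      (Algebra.lsmul ℂ ℂ (A ⧸ J) f₂) (Algebra.lsmul ℂ ℂ (A ⧸ J) f₃)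
      (v := Submodule.Quotient.mk 1) ?_ ?_ ?_ ?_ ?_ ?_ ?_
    all_goals
      simp only [Algebra.lsmul_coe, ← Submodule.Quotient.mk_smul, ← Submodule.Quotient.mk_add,
        ← Submodule.Quotient.mk_sub, mk_eq, smul_eq_mul, mul_one] at *
    · convert h using 1
      subst hfδ
      simp only [add_mul, sub_mul, smul_mul_assoc, mul_assoc]
    · intro w
      simp only [smul_smul, h13]
    · intro w
      simpa only [add_smul, sub_smul, smul_assoc, mul_smul, zero_smul] using
        congrArg (· • w) h21
    · intro w
      simpa only [add_smul, sub_smul, smul_assoc, mul_smul, zero_smul] using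
        congrArg (· • w) h23
    · simpa using h2J 1
    · simpa using h3J 1
    · rw [← hfδ]
      simpa using hδJ 1
    · convert hδJ f₁ using 1
      rw [sub_eq_zero.1 h1δ, hfδ]
      simp only [add_mul, sub_mul, smul_mul_assoc, mul_assoc]
  have hε : fδ * fε₃ ∈ J := by
    have h : fδ * fε₃ = (fδ * f₁ * f₂ - q⁻¹ • (fδ * f₂ * f₁)) * f₃
        - q⁻¹ • (fδ * f₃ * f₁ * f₂) + (q⁻¹ * q⁻¹) • (fδ * f₃ * f₂ * f₁) := by
      subst hfε₃
      simp only [qcomm, mul_sub, sub_mul, smul_sub, mul_smul_comm, smul_mul_assoc, mul_assoc]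
      module
    rw [h]
    exact add_mem (sub_mem (h3J _) (J.smul_of_tower_mem _ (h2J _)))
      (J.smul_of_tower_mem _ key)
  refine ⟨sub_mem hε (J.smul_of_tower_mem _ ?_), hε⟩
  have h : (a • (f₂ * f₃ * f₂) - f₃ * f₂ ^ 2) * f₁ ^ 3 = f₂ * f₂ * f₁ ^ 3 * f₃ := by
    have hc : f₁ ^ 3 * f₃ = f₃ * f₁ ^ 3 := Commute.pow_left h13 3
    rw [mul_assoc _ _ f₃, hc, ← mul_assoc]
    congr 1
    simp only [pow_two, mul_assoc] at h23 ⊢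
    linear_combination (norm := module) -h23
  rw [h]
  exact h3J _
end

section
/- In the quantized Serre setup below, for every integer i with 1 ≤ i ≤ n−1 one has f_{ε_{i+1}}·f_{ε_i} − q^{-1}·f_{ε_i}·f_{ε_{i+1}} ∈ J_{i+1}. Moreover, for i = 1 the exact identity f_{ε₂}·f_{ε₁} = q^{-1}·f_{ε₁}·f_{ε₂} − q^{-1}·f_δ holds in A. -/
/-- The Serre relation rewritten in terms of the `q`-commutator `d h - q⁻¹ h d`. -/
theorem qcomm_mul_eq_smul_of_serre {A : Type*} [Ring A] [Algebra ℂ A] {q : ℂ} (hq : q ≠ 0)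
    {d h : A} (hs : qcomm q⁻¹ h (qcomm q h d) = 0) :
    qcomm q⁻¹ d h * h = q • (h * qcomm q⁻¹ d h) := by
  rw [qcomm_inv_qcomm hq] at hs
  simp only [qcomm, mul_sub, sub_mul, mul_smul_comm, smul_mul_assoc, mul_assoc]
  linear_combination (norm := module) hs + inv_mul_cancel₀ hq • (h * (h * d))

/-- The Serre relation between `h` and `d` passes to `qcomm t c d` when `c` commutes with `h`. -/
theorem serre_qcomm_of_commute {A : Type*} [Ring A] [Algebra ℂ A] {q : ℂ} (t : ℂ) {c d h : A}
    (hc : Commute c h) (hs : qcomm q⁻¹ h (qcomm q h d) = 0) :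
    qcomm q⁻¹ h (qcomm q h (qcomm t c d)) = 0 := by
  have hh : ∀ x, h * (c * x) = c * (h * x) := fun x => by
    rw [← mul_assoc, ← hc.eq, mul_assoc]
  have h1 : qcomm q⁻¹ h (qcomm q h (qcomm t c d)) = qcomm t c (qcomm q⁻¹ h (qcomm q h d)) := by
    simp only [qcomm, mul_sub, sub_mul, mul_smul_comm, smul_mul_assoc, mul_assoc, hh, hc.eq,
      smul_sub]
    module
  rw [h1, hs]
  simp [qcomm]

/-- A vector killed by `H` and `G` on which `E` and `D` `q`-commute satisfies the Serre relation
of `E` and `G`, where `E = D H - q⁻¹ H D`. -/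
theorem serre_apply_eq {M : Type*} [AddCommGroup M] [Module ℂ M] {q : ℂ} (hq : q ≠ 0)
    (hq2 : q ^ 2 + 1 ≠ 0) (D H G E : M →ₗ[ℂ] M) (v : M) (hH : H v = 0) (hG : G v = 0)
    (hED : E (D v) = q⁻¹ • D (E v))
    (hE : ∀ w, E w = D (H w) - q⁻¹ • H (D w))
    (hEH : ∀ w, E (H w) = q • H (E w))
    (hGD : ∀ w, G (D w) = D (G w))
    (hS : ∀ w, H (H (G w)) - (q + q⁻¹) • H (G (H w)) + G (H (H w)) = 0) :
    (q + q⁻¹) • E (G (E v)) = G (E (E v)) := by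
  have ha : q + q⁻¹ ≠ 0 := by
    intro h0
    apply hq2
    field_simp at h0
    linear_combination h0
  have hHD : ∀ w, H (D w) = q • (D (H w) - E w) := fun w => by
    rw [hE w, sub_sub_cancel, smul_inv_smul₀ hq]
  have hHE : H (E v) = 0 := by
    have h0 := hEH v
    rw [hH, map_zero] at h0
    exact (smul_eq_zero.mp h0.symm).resolve_left hq
  have hHDv : H (D v) = -q • E v := by simp [hHD, hH]
  have hEE : E (E v) = -q⁻¹ • H (D (E v)) := by simp [hE (E v), hHE]
  have hHDD : H (D (D v)) = -(q ^ 2 + 1) • D (E v) := by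
    rw [hHD, hHDv, hED, map_smul]
    match_scalars
    field_simp
    ring
  have hHGDE : (q + q⁻¹) • H (G (D (E v))) = -q • G (E (E v)) := by
    have h0 := hS (D (D v))
    rw [hGD, hGD, hG, hHDD] at h0
    simp only [map_zero, map_smul] at h0
    rw [hEE, map_smul]
    refine smul_right_injective M hq2 ?_
    dsimp only
    rw [smul_smul (-q), neg_mul_neg, mul_inv_cancel₀ hq, one_smul]
    linear_combination (norm := module) h0
  have hHGE : H (G (E v)) = 0 := by
    have h0 := hS (D v)
    rw [hGD, hG, hHDv] at h0
    simp only [map_zero, map_smul, hHE, smul_zero, add_zero, zero_sub, neg_eq_zero] at h0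
    exact (smul_eq_zero.mp ((smul_eq_zero.mp h0).resolve_left ha)).resolve_left (neg_ne_zero.mpr hq)
  rw [hE (G (E v)), hHGE, ← hGD, map_zero, zero_sub, smul_neg, smul_comm, hHGDE, smul_smul,
    mul_neg, inv_mul_cancel₀ hq, neg_smul, one_smul, neg_neg]

/-- Modulo a left ideal containing `h` and `g`, the `q`-commutation of `d` with
`e = d h - q⁻¹ h d` implies that of `e` with `e g - q⁻¹ g e`. -/
theorem qcomm_qcommute_mem {A : Type*} [Ring A] [Algebra ℂ A] {q : ℂ} (hq : q ≠ 0)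
    (hq2 : q ^ 2 + 1 ≠ 0) (J : Submodule A A) {d h g e : A} (he : e = qcomm q⁻¹ d h)
    (hh : h ∈ J) (hg : g ∈ J) (hed : e * d - q⁻¹ • (d * e) ∈ J)
    (hgd : Commute g d) (hhd : qcomm q⁻¹ h (qcomm q h d) = 0)
    (hhg : qcomm q⁻¹ h (qcomm q h g) = 0) :
    qcomm q⁻¹ e g * e - q⁻¹ • (e * qcomm q⁻¹ e g) ∈ J := by
  let φ := Algebra.lsmul ℂ ℂ (A ⧸ J) (A := A)
  let v : A ⧸ J := Submodule.Quotient.mk 1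
  have hφ : ∀ x, φ x v = Submodule.Quotient.mk x := fun x => by
    simp only [φ, v, Algebra.lsmul_coe]
    rw [← Submodule.Quotient.mk_smul, smul_eq_mul, mul_one]
  have hmem : ∀ x, x ∈ J ↔ φ x v = 0 := fun x => by
    rw [hφ, Submodule.Quotient.mk_eq_zero]
  have hmul : ∀ x y w, φ (x * y) w = φ x (φ y w) := fun x y w => by
    rw [map_mul, Module.End.mul_apply]
  have key := serre_apply_eq hq hq2 (φ d) (φ h) (φ g) (φ e) v ((hmem h).mp hh) ((hmem g).mp hg)
    (by
      have h0 := (hmem _).mp hed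
      rw [map_sub, map_smul, LinearMap.sub_apply, LinearMap.smul_apply, hmul, hmul] at h0
      exact sub_eq_zero.mp h0)
    (fun w => by
      rw [← hmul, ← hmul, ← LinearMap.smul_apply, ← LinearMap.sub_apply, ← map_smul, ← map_sub, he]
      rfl)
    (fun w => by
      rw [← hmul, ← hmul, ← LinearMap.smul_apply, ← map_smul, he, qcomm_mul_eq_smul_of_serre hq hhd])
    (fun w => by rw [← hmul, ← hmul, hgd.eq])
    (fun w => by
      rw [qcomm_inv_qcomm hq] at hhg
      have h0 := congrArg (fun x => φ x w) hhg
      simpa only [map_add, map_sub, map_smul, LinearMap.add_apply, LinearMap.sub_apply,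
        LinearMap.smul_apply, hmul, map_zero, LinearMap.zero_apply] using h0)
  have hgv := (hmem g).mp hg
  rw [hmem]
  simp only [qcomm, map_sub, map_smul, LinearMap.sub_apply, LinearMap.smul_apply, hmul, hgv,
    map_zero, zero_sub, map_neg]
  rw [← key]
  match_scalars
  field_simp
  ring

/-- In the quantized Serre setup, `f_{ε_{i+1}}·f_{ε_i} ≡ q⁻¹·f_{ε_i}·f_{ε_{i+1}}`
modulo `J_{i+1}`, and for `i = 1` the exact identity
`f_{ε₂}·f_{ε₁} = q⁻¹·f_{ε₁}·f_{ε₂} − q⁻¹·f_δ` holds. -/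
theorem feps_qcommute {A : Type*} [Ring A] [Algebra ℂ A]
    (q : ℂ) (hq : q ≠ 0) (hroot : ∀ k : ℕ, k ≠ 0 → q ^ k ≠ 1)
    (n : ℕ) (hn : 2 ≤ n) (f : ℕ → A)
    (hR1 : ∀ i j, 1 ≤ i → i ≤ n → 1 ≤ j → j ≤ n →
      2 ≤ ((i : ℤ) - (j : ℤ)).natAbs → f i * f j = f j * f i)
    (hR2 : ∀ i j, 2 ≤ i → i ≤ n → 1 ≤ j → j ≤ n →
      ((i : ℤ) - (j : ℤ)).natAbs = 1 →
      qcomm q⁻¹ (f i) (qcomm q (f i) (f j)) = 0)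
    (fδ : A) (hfδ : fδ = qcomm q⁻¹ (f 1) (qcomm q (f 1) (f 2)))
    (hR3 : f 1 * fδ = fδ * f 1)
    (fε : ℕ → A) (hfε1 : fε 1 = f 1)
    (hfεs : ∀ i, 1 ≤ i → i < n → fε (i + 1) = qcomm q⁻¹ (fε i) (f (i + 1)))
    (J : ℕ → Submodule A A)
    (hJ : ∀ m, J m = Submodule.span A (insert fδ (f '' Set.Icc 2 m))) :
    (∀ i, 1 ≤ i → i ≤ n - 1 →
      fε (i + 1) * fε i - q⁻¹ • (fε i * fε (i + 1)) ∈ J (i + 1)) ∧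
    fε 2 * fε 1 = q⁻¹ • (fε 1 * fε 2) - q⁻¹ • fδ := by
  have hq2 : q ^ 2 + 1 ≠ 0 := fun h0 =>
    hroot 4 (by norm_num) (by linear_combination (q ^ 2 - 1) * h0)
  have hbase : fε 2 * fε 1 = q⁻¹ • (fε 1 * fε 2) - q⁻¹ • fδ := by
    rw [hfεs 1 le_rfl (by omega), hfε1, hfδ, qcomm_inv_qcomm hq]
    simp only [qcomm, mul_sub, sub_mul, mul_smul_comm, smul_mul_assoc, mul_assoc, smul_sub,
      smul_add]
    match_scalars <;> field_simp <;> ring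
  have hcomm : ∀ i, 1 ≤ i → ∀ j, i + 2 ≤ j → j ≤ n → Commute (fε i) (f j) := by
    intro i hi
    induction i, hi using Nat.le_induction with
    | base =>
      intro j hj hjn
      rw [hfε1]
      exact hR1 1 j le_rfl (by omega) (by omega) hjn (by omega)
    | succ i hi ih =>
      intro j hj hjn
      have h1 : Commute (fε i) (f j) := ih j (by omega) hjn
      have h2 : Commute (f (i + 1)) (f j) :=
        hR1 (i + 1) j (by omega) (by omega) (by omega) hjn (by omega)
      rw [hfεs i hi (by omega)]
      exact (h1.mul_left h2).sub_left ((h2.mul_left h1).smul_left _)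
  have hserre : ∀ i, 1 ≤ i → i < n →
      qcomm q⁻¹ (f (i + 1)) (qcomm q (f (i + 1)) (fε i)) = 0 := by
    intro i hi hin
    rcases hi.eq_or_lt with rfl | hi
    · rw [hfε1]
      exact hR2 2 1 le_rfl (by omega) le_rfl (by omega) (by norm_num)
    · obtain ⟨k, rfl⟩ : ∃ k, i = k + 1 := ⟨i - 1, by omega⟩
      rw [hfεs k (by omega) (by omega)]
      exact serre_qcomm_of_commute _ (hcomm k (by omega) _ (by omega) (by omega))
        (hR2 _ _ (by omega) (by omega) (by omega) (by omega) (by omega))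
  have hfJ : ∀ m i, 2 ≤ i → i ≤ m → f i ∈ J m := fun m i hi him => by
    rw [hJ]
    exact Submodule.subset_span (Set.mem_insert_of_mem _ ⟨i, ⟨hi, him⟩, rfl⟩)
  have hJmono : Monotone J := fun a b hab => by
    rw [hJ, hJ]
    exact Submodule.span_mono
      (Set.insert_subset_insert (Set.image_mono (Set.Icc_subset_Icc_right hab)))
  refine ⟨fun i hi => ?_, hbase⟩
  induction i, hi using Nat.le_induction with
  | base =>
    intro _
    have hδ : fδ ∈ J 2 := by
      rw [hJ]
      exact Submodule.subset_span (Set.mem_insert _ _)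
    rw [hbase, sub_sub_cancel_left, ← neg_smul]
    exact (J 2).smul_of_tower_mem _ hδ
  | succ i hi ih =>
    intro hin
    rw [hfεs (i + 1) (by omega) (by omega)]
    exact qcomm_qcommute_mem hq hq2 _ (hfεs i hi (by omega)) (hfJ _ _ (by omega) (by omega))
      (hfJ _ _ (by omega) le_rfl) (hJmono (Nat.le_succ _) (ih (by omega)))
      (hcomm i hi _ le_rfl (by omega)).symm (hserre i hi (by omega))
      (hR2 _ _ (by omega) (by omega) (by omega) (by omega) (by omega))
end

section
/- In the quantized Serre setup below, for all integers i and m with 2 ≤ i < m ≤ n, the element f_i commutes with f_{ε_m}: f_i·f_{ε_m} = f_{ε_m}·f_i. -/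
/-- The nested twisted commutator `[y, [y, x]_q]_{q⁻¹}` vanishes iff the expanded quantum Serre
relation holds. -/
theorem qcomm_inv_qcomm_eq_zero_iff {A : Type*} [Ring A] [Algebra ℂ A] {q : ℂ} (hq : q ≠ 0)
    (x y : A) :
    qcomm q⁻¹ y (qcomm q y x) = 0 ↔
      y * (y * x) + x * (y * y) = (q + q⁻¹) • (y * (x * y)) := by
  rw [← sub_eq_zero (b := (q + q⁻¹) • (y * (x * y)))]
  have h : qcomm q⁻¹ y (qcomm q y x) =
      y * (y * x) + x * (y * y) - (q + q⁻¹) • (y * (x * y)) := by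
    simp only [qcomm, mul_sub, sub_mul, mul_smul_comm, smul_mul_assoc, mul_assoc, smul_sub,
      smul_smul, inv_mul_cancel₀ hq]
    module
  rw [h]

/-- Twisted commutators of elements commuting with `y` commute with `y`. -/
theorem Commute.qcomm_right {A : Type*} [Ring A] [Algebra ℂ A] {y u v : A} (t : ℂ)
    (hu : Commute y u) (hv : Commute y v) : Commute y (qcomm t u v) :=
  (hu.mul_right hv).sub_right ((hv.mul_right hu).smul_right t)

/-- The quantum Serre relation for `v` passes to `[u, v]_t` when `y` commutes with `u`. -/
theorem serre_qcomm {A : Type*} [Ring A] [Algebra ℂ A] {a : ℂ} {y u v : A} (t : ℂ)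
    (hu : Commute y u)
    (hv : y * (y * v) + v * (y * y) = a • (y * (v * y))) :
    y * (y * qcomm t u v) + qcomm t u v * (y * y) = a • (y * (qcomm t u v * y)) := by
  have hl := congrArg (u * ·) hv
  have hr := congrArg (· * u) hv
  have hu' : ∀ z, y * (u * z) = u * (y * z) := fun z => hu.left_comm z
  simp only [qcomm, mul_sub, sub_mul, mul_add, add_mul, mul_smul_comm, smul_mul_assoc, mul_assoc,
    hu', hu.eq] at hl hr ⊢
  linear_combination (norm := module) hl - t • hr

/-- If `x` and `z` commute and both satisfy the quantum Serre relation with `y`, then `y` commutes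
with `[[x, y]_{q⁻¹}, z]_{q⁻¹}`. -/
theorem commute_qcomm_qcomm_of_serre {A : Type*} [Ring A] [Algebra ℂ A] {q : ℂ} (hq : q ≠ 0)
    (ha : q + q⁻¹ ≠ 0) {x y z : A} (hxz : Commute x z)
    (hx : y * (y * x) + x * (y * y) = (q + q⁻¹) • (y * (x * y)))
    (hz : y * (y * z) + z * (y * y) = (q + q⁻¹) • (y * (z * y))) :
    Commute y (qcomm q⁻¹ (qcomm q⁻¹ x y) z) := by
  have hxz' : ∀ w, x * (z * w) = z * (x * w) := fun w => hxz.left_comm w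
  have hqq : q⁻¹ * (q + q⁻¹) = 1 + q⁻¹ * q⁻¹ := by field_simp
  generalize q⁻¹ = p at *
  generalize q + p = a at *
  have h₁ := congrArg (· * z) hx
  have h₂ := congrArg (z * ·) hx
  have h₃ := congrArg (· * x) hz
  have h₄ := congrArg (x * ·) hz
  refine smul_right_injective A ha ?_
  simp only [qcomm, mul_sub, sub_mul, mul_add, add_mul, mul_smul_comm, smul_mul_assoc, mul_assoc,
    hxz', hxz.eq, smul_sub] at h₁ h₂ h₃ h₄ ⊢
  linear_combination (norm := module) h₄ - h₁ + (p * p) • h₂ - (p * p) • h₃ +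
    hqq • (z * (x * (y * y)) - y * (y * (z * x)))

/-- In the quantized Serre setup, `f_i` commutes with `f_{ε_m}` for `2 ≤ i < m ≤ n`. -/
theorem fi_commutes_feps {A : Type*} [Ring A] [Algebra ℂ A]
    (q : ℂ) (hq : q ≠ 0) (hroot : ∀ k : ℕ, k ≠ 0 → q ^ k ≠ 1)
    (n : ℕ) (hn : 2 ≤ n) (f : ℕ → A)
    (hR1 : ∀ i j, 1 ≤ i → i ≤ n → 1 ≤ j → j ≤ n →
      2 ≤ ((i : ℤ) - (j : ℤ)).natAbs → f i * f j = f j * f i)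
    (hR2 : ∀ i j, 2 ≤ i → i ≤ n → 1 ≤ j → j ≤ n →
      ((i : ℤ) - (j : ℤ)).natAbs = 1 →
      qcomm q⁻¹ (f i) (qcomm q (f i) (f j)) = 0)
    (fδ : A) (hfδ : fδ = qcomm q⁻¹ (f 1) (qcomm q (f 1) (f 2)))
    (hR3 : f 1 * fδ = fδ * f 1)
    (fε : ℕ → A) (hfε1 : fε 1 = f 1)
    (hfεs : ∀ i, 1 ≤ i → i < n → fε (i + 1) = qcomm q⁻¹ (fε i) (f (i + 1))) :
    ∀ i m, 2 ≤ i → i < m → m ≤ n → f i * fε m = fε m * f i := by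
  have ha : q + q⁻¹ ≠ 0 := by
    intro h
    have h2 : q ^ 2 = -1 := by
      field_simp at h
      linear_combination h
    exact hroot 4 (by norm_num) (by linear_combination (q ^ 2 - 1) * h2)
  have hfar : ∀ k, 1 ≤ k → ∀ j, k + 2 ≤ j → j ≤ n → Commute (f j) (fε k) := by
    intro k hk
    induction k, hk using Nat.le_induction with
    | base =>
      intro j hj hjn
      rw [hfε1]
      exact hR1 j 1 (by omega) hjn le_rfl (by omega) (by omega)
    | succ k hk ih =>
      intro j hj hjn
      rw [hfεs k hk (by omega)]
      exact (ih j (by omega) hjn).qcomm_right _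
        (hR1 j (k + 1) (by omega) hjn (by omega) (by omega) (by omega))
  have hserre : ∀ k, 1 ≤ k → k + 1 ≤ n →
      f (k + 1) * (f (k + 1) * fε k) + fε k * (f (k + 1) * f (k + 1)) =
        (q + q⁻¹) • (f (k + 1) * (fε k * f (k + 1))) := by
    intro k hk hkn
    have hf := (qcomm_inv_qcomm_eq_zero_iff hq _ _).1
      (hR2 (k + 1) k (by omega) hkn hk (by omega) (by omega))
    obtain rfl | ⟨l, hl, rfl⟩ : k = 1 ∨ ∃ l, 1 ≤ l ∧ k = l + 1 := by
      obtain rfl | h := eq_or_ne k 1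
      · exact .inl rfl
      · exact .inr ⟨k - 1, by omega, by omega⟩
    · rwa [hfε1]
    · rw [hfεs l hl (by omega)]
      exact serre_qcomm _ (hfar l hl _ (by omega) hkn) hf
  intro i m hi him
  induction m, him using Nat.le_induction with
  | base =>
    intro hin
    obtain ⟨k, rfl⟩ : ∃ k, i = k + 1 := ⟨i - 1, by omega⟩
    rw [hfεs (k + 1) (by omega) (by omega), hfεs k (by omega) (by omega)]
    exact commute_qcomm_qcomm_of_serre hq ha (hfar k (by omega) _ le_rfl hin).symm
      (hserre k (by omega) (by omega))
      ((qcomm_inv_qcomm_eq_zero_iff hq _ _).1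
        (hR2 (k + 1) (k + 1 + 1) hi (by omega) (by omega) hin (by omega)))
  | succ m him ih =>
    intro hmn
    rw [hfεs m (by omega) (by omega)]
    exact Commute.qcomm_right _ (ih (by omega))
      (hR1 i (m + 1) (by omega) (by omega) (by omega) hmn (by omega))
end

section
/- Let A be a unital associative algebra over ℂ, p ∈ ℂ with p⁴ ≠ 1, and set q := p². Suppose e, f, L, L' ∈ A satisfy: L·L' = L'·L = 1, L·e = p·e·L, L·f = p^{-1}·f·L, and e·f − f·e = (L² − (L')²)/(q − q^{-1}). Then for every integer m ≥ 1, the element e^m·f^m − (∏_{l=1}^{m} (p^l − p^{−l})/(p − p^{−1})) · ∏_{l=0}^{m−1} (p^{−l}·L² − p^{l}·(L')²)/(q − q^{−1}) lies in the left ideal A·e = { x·e : x ∈ A }. -/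
/-- Inverting `L` inverts its commutation factor with `e`. -/
lemma inverse_mul_eq_smul_mul {A : Type*} [Ring A] [Algebra ℂ A] {c : ℂ} (hc : c ≠ 0)
    {e L L' : A} (hLL' : L * L' = 1) (hL'L : L' * L = 1) (h : L * e = c • (e * L)) :
    L' * e = c⁻¹ • (e * L') := by
  have h1 : e * L' = c • (L' * e) :=
    calc e * L' = L' * (L * e) * L' := by rw [← mul_assoc L', hL'L, one_mul]
      _ = c • (L' * e) := by
        rw [h, mul_smul_comm, smul_mul_assoc, mul_assoc, mul_assoc, hLL', mul_one]
  rw [h1, inv_smul_smul₀ hc]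

lemma sq_mul_eq_smul_mul {A : Type*} [Ring A] [Algebra ℂ A] {c : ℂ} {e L : A}
    (h : L * e = c • (e * L)) : L ^ 2 * e = c ^ 2 • (e * L ^ 2) := by
  rw [sq, mul_assoc, h, mul_smul_comm, ← mul_assoc, h, smul_mul_assoc, smul_smul, ← sq,
    mul_assoc]

/-- The commutation of `e` with a power of `f` in a quantized `sl(2)`-triple. -/
lemma mul_pow_succ_eq {A : Type*} [Ring A] [Algebra ℂ A] {p : ℂ} (hp0 : p ≠ 0)
    (hp : p - p⁻¹ ≠ 0) {k : ℂ} {e f X Y : A}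
    (hX : X * f = (p⁻¹) ^ 2 • (f * X)) (hY : Y * f = p ^ 2 • (f * Y))
    (hef : e * f - f * e = k • (X - Y)) (m : ℕ) :
    e * f ^ (m + 1) = f ^ (m + 1) * e +
      ((p ^ ((m + 1 : ℕ) : ℤ) - p ^ (-((m + 1 : ℕ) : ℤ))) / (p - p⁻¹)) •
        (f ^ m * (k • (p ^ (-(m : ℤ)) • X - p ^ (m : ℤ) • Y))) := by
  have hp' : p ^ 2 - 1 ≠ 0 := by
    intro h
    apply hp
    field_simp
    simpa using h
  simp only [zpow_neg, zpow_natCast]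
  induction m with
  | zero =>
    simp [div_self hp, ← hef]
  | succ m ih =>
    have key : e * f = f * e + k • (X - Y) := by rw [← hef]; abel
    rw [pow_succ f (m + 1), ← mul_assoc, ih, add_mul, mul_assoc _ e, key]
    simp only [mul_add, mul_sub, sub_mul, smul_mul_assoc, mul_smul_comm, smul_sub, smul_smul,
      mul_assoc, hX, hY]
    simp only [← mul_assoc, ← pow_succ]
    match_scalars <;> field_simp <;> ring


/-- Harish-Chandra type identity in a quantized `sl(2)`-triple:
`e^m·f^m ≡ ∏_{l=1}^{m} [l]_p/[1]_p · ∏_{l=0}^{m−1} (p^{−l}L² − p^{l}L'²)/(q−q⁻¹)`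
modulo the left ideal `A·e`, where `q = p²`. -/
theorem em_fm_mod_left_ideal {A : Type*} [Ring A] [Algebra ℂ A]
    (p : ℂ) (hp : p ^ 4 ≠ 1) (e f L L' : A)
    (hLL' : L * L' = 1) (hL'L : L' * L = 1)
    (hLe : L * e = p • (e * L)) (hLf : L * f = p⁻¹ • (f * L))
    (hef : e * f - f * e = ((p ^ 2 - (p ^ 2)⁻¹)⁻¹) • (L ^ 2 - L' ^ 2)) :
    ∀ m : ℕ, 1 ≤ m → ∃ x : A,
      e ^ m * f ^ m -
        (∏ l ∈ Finset.Icc 1 m, (p ^ (l : ℤ) - p ^ (-(l : ℤ))) / (p - p⁻¹)) •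
          ((List.range m).map (fun l =>
            ((p ^ 2 - (p ^ 2)⁻¹)⁻¹) •
              (p ^ (-(l : ℤ)) • L ^ 2 - p ^ (l : ℤ) • L' ^ 2))).prod
        = x * e := by
  intro m hm
  rcases eq_or_ne p 0 with rfl | hp0
  · have he : e = 0 := by
      rw [← one_mul e, ← hL'L, mul_assoc, hLe, zero_smul, mul_zero]
    refine ⟨0, ?_⟩
    rw [Finset.prod_eq_zero (Finset.mem_Icc.2 ⟨le_rfl, hm⟩) (by simp), he,
      zero_pow (by lia)]
    simp
  have hpp : p - p⁻¹ ≠ 0 := by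
    intro h
    apply hp
    have h2 : p ^ 2 = 1 := by
      field_simp at h
      linear_combination h
    linear_combination (p ^ 2 + 1) * h2
  clear hm
  have hXf := sq_mul_eq_smul_mul hLf
  have hYf := sq_mul_eq_smul_mul (inverse_mul_eq_smul_mul (inv_ne_zero hp0) hLL' hL'L hLf)
  have hXe := sq_mul_eq_smul_mul hLe
  have hYe := sq_mul_eq_smul_mul (inverse_mul_eq_smul_mul hp0 hLL' hL'L hLe)
  rw [inv_inv] at hYf
  have comm := mul_pow_succ_eq hp0 hpp hXf hYf hef
  have heX : e * L ^ 2 = (p⁻¹) ^ 2 • (L ^ 2 * e) := by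
    rw [hXe, smul_smul, ← mul_pow, inv_mul_cancel₀ hp0, one_pow, one_smul]
  have heY : e * L' ^ 2 = p ^ 2 • (L' ^ 2 * e) := by
    rw [hYe, smul_smul, ← mul_pow, mul_inv_cancel₀ hp0, one_pow, one_smul]
  have cross (k a b : ℂ) : e * (k • (a • L ^ 2 - b • L' ^ 2)) =
      (k • ((a * (p⁻¹) ^ 2) • L ^ 2 - (b * p ^ 2) • L' ^ 2)) * e := by
    simp only [mul_sub, sub_mul, smul_mul_assoc, mul_smul_comm, heX, heY, smul_smul]
  have hprod (g : ℤ → A) (n : ℕ) : (((List.range (n + 1) : List ℕ) : List ℤ).map g).prod =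
      (((List.range n : List ℕ) : List ℤ).map g).prod * g n := by
    simp [List.range_succ]
  induction m with
  | zero => exact ⟨0, by simp⟩
  | succ m ih =>
    obtain ⟨x, hx⟩ := ih
    rw [sub_eq_iff_eq_add] at hx
    rw [Finset.prod_Icc_succ_top (by lia), hprod, pow_succ e, mul_assoc, comm, mul_add,
      mul_smul_comm, ← mul_assoc _ (f ^ m), hx, add_mul, mul_assoc x e, cross, ← mul_assoc x,
      ← mul_assoc, smul_mul_assoc, smul_add, smul_smul, mul_comm (_ / _ : ℂ), ← add_assoc,
      add_sub_cancel_right, ← smul_mul_assoc, ← add_mul]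
    exact ⟨_, rfl⟩
end
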